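/- The function α : (p−1, ∞) → ℝ defined by α(σ) = p(σ + γ̄(σ))/(σ − p + 1) is strictly decreasing on the interval (p−1, ∞). -/

import Mathlib

open MeasureTheory Real Set Metric Filter
open scoped ENNReal NNReal RealInnerProductSpace

noncomputable section

/-- Euclidean space `ℝ^m`. -/
abbrev Em (m : ℕ) := EuclideanSpace ℝ (Fin m)

/-- A Lipschitz function with compact support. -/
def LipCS {m : ℕ} (φ : Em m → ℝ) : Prop :=
  (∃ L : ℝ≥0, LipschitzWith L φ) ∧ HasCompactSupport φ

/-- `u` is a weak solution of `-Δ_p u = V |u|^(σ-1) u` on `ℝ^m`: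
`u` is `C¹`, `|∇u|^p` and `V |u|^(σ+1)` are locally integrable, and the weak
formulation holds against every Lipschitz test function with compact support. -/
def IsWeakSol {m : ℕ} (p σ : ℝ) (V u : Em m → ℝ) : Prop :=
  ContDiff ℝ 1 u ∧
  LocallyIntegrable (fun x => ‖gradient u x‖ ^ p) volume ∧
  LocallyIntegrable (fun x => V x * |u x| ^ (σ + 1)) volume ∧
  ∀ φ : Em m → ℝ, LipCS φ →
    (∫ x, ‖gradient u x‖ ^ (p - 2) * ⟪gradient u x, gradient φ x⟫) =
      ∫ x, V x * |u x| ^ (σ - 1) * u x * φ x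

/-- Stability of a weak solution `u`. -/
def IsStable {m : ℕ} (p σ : ℝ) (V u : Em m → ℝ) : Prop :=
  ∀ φ : Em m → ℝ, LipCS φ →
    σ * ∫ x, V x * |u x| ^ (σ - 1) * φ x ^ 2 ≤
      (∫ x, ‖gradient u x‖ ^ (p - 2) * ‖gradient φ x‖ ^ 2) +
        (p - 2) * ∫ x, ‖gradient u x‖ ^ (p - 4) * ⟪gradient u x, gradient φ x⟫ ^ 2

/-- `γ̄ = (2σ - p + 1 + 2√(σ(σ - p + 1)))/(p - 1)`. -/
def gammaBar (p σ : ℝ) : ℝ := (2 * σ - p + 1 + 2 * Real.sqrt (σ * (σ - p + 1))) / (p - 1)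

/-- `α = p (σ + γ̄)/(σ - p + 1)`. -/
def alphaC (p σ : ℝ) : ℝ := p * (σ + gammaBar p σ) / (σ - p + 1)

/-- `β = (γ̄ + p - 1)/(σ - p + 1)`. -/
def betaC (p σ : ℝ) : ℝ := (gammaBar p σ + p - 1) / (σ - p + 1)

/-- The critical exponent `σ_c(m, p)`. -/
def sigmaC (mr p : ℝ) : ℝ :=
  (((p - 1) * mr - p) ^ 2 + p ^ 2 * (p - 2) - p ^ 2 * (p - 1) * mr +
      2 * p ^ 2 * Real.sqrt ((p - 1) * (mr - 1))) /
    ((mr - p) * ((p - 1) * mr - p * (p + 3)))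

/-- Condition (HP1). -/
def HP1 {m : ℕ} (p σ : ℝ) (V : Em m → ℝ) : Prop :=
  ∃ C C₀ R₀ ε₀ : ℝ, 0 < C ∧ 0 < C₀ ∧ 0 < R₀ ∧ 0 < ε₀ ∧
    ∀ ε ∈ Set.Ioo (0 : ℝ) ε₀, ∀ R > R₀,
      (∫⁻ x in Metric.ball (0 : Em m) R \ Metric.ball (0 : Em m) (R / 2),
          ENNReal.ofReal (V x ^ (-(betaC p σ) + ε))) ≤
        ENNReal.ofReal (C * R ^ (alphaC p σ + C₀ * ε) * (Real.log R)⁻¹)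

/-- Condition (HP2). -/
def HP2 {m : ℕ} (p σ : ℝ) (V : Em m → ℝ) : Prop :=
  ∃ C C₀ R₀ ε₀ θ b : ℝ, 0 < C ∧ 0 < C₀ ∧ 0 < R₀ ∧ 0 < ε₀ ∧ 0 < θ ∧
    b < -1 + θ / (σ - p + 1) ∧
    ∀ ε ∈ Set.Ioo (0 : ℝ) ε₀, ∀ R > R₀,
      (∫⁻ x in Metric.ball (0 : Em m) R \ Metric.ball (0 : Em m) (R / 2),
          ENNReal.ofReal (V x ^ (-(betaC p σ) + ε))) ≤
        ENNReal.ofReal (C * R ^ (alphaC p σ + C₀ * ε) * Real.log R ^ b *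
          Real.exp (-θ * ε * Real.log (R / 2) * Real.log (Real.log (R / 2))))

/-- Closed form of `α` in which every dependence on `σ` is through `(p - 1)/(σ - p + 1)`. -/
theorem alphaC_eq {p σ : ℝ} (hp : 1 < p) (hσ : p - 1 < σ) :
    alphaC p σ = p / (p - 1) * (p + 1 + p * ((p - 1) / (σ - p + 1)) +
      2 * Real.sqrt (1 + (p - 1) / (σ - p + 1))) := by
  have hq : p - 1 ≠ 0 := by linarith
  have ht : 0 < σ - p + 1 := by linarith
  have hsqrt : Real.sqrt (σ * (σ - p + 1)) =
      (σ - p + 1) * Real.sqrt (1 + (p - 1) / (σ - p + 1)) := by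
    have hrw : σ * (σ - p + 1) = (σ - p + 1) ^ 2 * (1 + (p - 1) / (σ - p + 1)) := by
      field_simp
      ring
    rw [hrw, Real.sqrt_mul (sq_nonneg _), Real.sqrt_sq ht.le]
  unfold alphaC gammaBar
  rw [hsqrt]
  generalize Real.sqrt (1 + (p - 1) / (σ - p + 1)) = s
  field_simp
  ring

theorem alpha_strictAnti (p : ℝ) (hp : 2 ≤ p) :
    StrictAntiOn (fun σ => alphaC p σ) (Set.Ioi (p - 1)) := by
  intro σ hσ τ hτ hστ
  have hp1 : 1 < p := by linarith
  have hq : 0 < p - 1 := by linarith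
  rw [Set.mem_Ioi] at hσ hτ
  have ht : 0 < σ - p + 1 := by linarith
  have hdiv : (p - 1) / (τ - p + 1) < (p - 1) / (σ - p + 1) :=
    div_lt_div_of_pos_left hq ht (by linarith)
  have hsqrt : Real.sqrt (1 + (p - 1) / (τ - p + 1)) ≤
      Real.sqrt (1 + (p - 1) / (σ - p + 1)) :=
    Real.sqrt_le_sqrt (by linarith)
  have hmul := mul_lt_mul_of_pos_left hdiv (by linarith : 0 < p)
  change alphaC p τ < alphaC p σ
  rw [alphaC_eq hp1 hσ, alphaC_eq hp1 hτ]
  exact mul_lt_mul_of_pos_left (by linarith) (div_pos (by linarith) hq)
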